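/- arXiv:2209.00715 — 2 statements merged into one kernel-verified Lean document; each statement's English description precedes it below -/
import Mathlib

section
/- If h ∈ F is the canonical partial inverse of g ∈ F, then g is the canonical partial inverse of h; in particular the bands generated by |g| and |h| coincide and gh = hg = P_{|h|}e. -/
/-- In a Dedekind complete Riesz space, the band projection of `x` onto the band
generated by `|u|`: `P_{|u|} x = sup_n (x⁺ ⊓ n|u|) - sup_n (x⁻ ⊓ n|u|)`. -/
noncomputable def bandProj {F : Type*} [AddCommGroup F] [ConditionallyCompleteLattice F]
    [CovariantClass F F (· + ·) (· ≤ ·)] (u x : F) : F :=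
  sSup (Set.range fun n : ℕ => (x ⊔ 0) ⊓ n • |u|) -
    sSup (Set.range fun n : ℕ => ((-x) ⊔ 0) ⊓ n • |u|)

/-- `F` is a universally complete Riesz space with weak order unit `e`, equipped with
its `f`-algebra structure in which `e = 1` is the algebraic unit: `F` is a Dedekind
complete (conditionally complete) Riesz space which is laterally complete, the
multiplication makes it an `f`-algebra, and `1` is a weak order unit. -/
structure UCFAlgebra (F : Type*) [CommRing F] [ConditionallyCompleteLattice F]
    [CovariantClass F F (· + ·) (· ≤ ·)] [Module ℝ F] [PosSMulMono ℝ F] : Prop where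
  /-- products of positives are positive -/
  mul_nonneg : ∀ x y : F, 0 ≤ x → 0 ≤ y → 0 ≤ x * y
  /-- the `f`-algebra property: `x ⊓ y = 0` implies `(x z) ⊓ y = 0` for `z ≥ 0` -/
  falg : ∀ x y z : F, x ⊓ y = 0 → 0 ≤ z → (x * z) ⊓ y = 0
  one_pos : (0 : F) < 1
  /-- the algebraic unit `e = 1` is a weak order unit -/
  one_weak : ∀ x : F, 0 ≤ x → x ⊓ 1 = 0 → x = 0
  /-- lateral completeness: every pairwise disjoint set of positive elements is
  bounded above (hence, by Dedekind completeness, has a supremum) -/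
  laterallyComplete : ∀ S : Set F, (∀ x ∈ S, 0 ≤ x) →
    (S.Pairwise fun x y => x ⊓ y = 0) → BddAbove S

/-- `h` is a partial inverse of `g`: `gh = hg = P_{|g|} e` where `e = 1`. -/
def IsPartialInverse {F : Type*} [CommRing F] [ConditionallyCompleteLattice F]
    [CovariantClass F F (· + ·) (· ≤ ·)] (g h : F) : Prop :=
  g * h = bandProj g 1 ∧ h * g = bandProj g 1

/-- `h` is the canonical partial inverse of `g`: a partial inverse with
`(I - P_{|g|}) h = 0`, i.e. `h` lies in the band generated by `|g|`. -/
def IsCanonicalPartialInverse {F : Type*} [CommRing F] [ConditionallyCompleteLattice F]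
    [CovariantClass F F (· + ·) (· ≤ ·)] (g h : F) : Prop :=
  IsPartialInverse g h ∧ h - bandProj g h = 0

section RieszSpace

variable {F : Type*} [AddCommGroup F] [ConditionallyCompleteLattice F]

theorem inf_eq_zero_of_le_right {y a b : F} (hy : y ⊓ b = 0) (ha : 0 ≤ a) (hab : a ≤ b) :
    y ⊓ a = 0 :=
  le_antisymm ((inf_le_inf_left y hab).trans hy.le) (le_inf (hy.ge.trans inf_le_left) ha)

/-- The component of a positive element `x` in the band generated by `|u|`. -/
noncomputable def posBandProj (u x : F) : F :=
  sSup (Set.range fun n : ℕ => x ⊓ n • |u|)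

theorem isLUB_posBandProj (u x : F) :
    IsLUB (Set.range fun n : ℕ => x ⊓ n • |u|) (posBandProj u x) :=
  isLUB_csSup (Set.range_nonempty _) ⟨x, by rintro _ ⟨n, rfl⟩; exact inf_le_left⟩

theorem posBandProj_le (u x : F) : posBandProj u x ≤ x :=
  (isLUB_posBandProj u x).2 (by rintro _ ⟨n, rfl⟩; exact inf_le_left)

theorem posBandProj_nonneg (u : F) {x : F} (hx : 0 ≤ x) : 0 ≤ posBandProj u x := by
  simpa [hx] using (isLUB_posBandProj u x).1 ⟨0, rfl⟩

theorem posBandProj_eq_self {u x : F} (hx : x ≤ |u|) : posBandProj u x = x := by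
  refine le_antisymm (posBandProj_le u x) ?_
  simpa [hx] using (isLUB_posBandProj u x).1 ⟨1, rfl⟩

variable [CovariantClass F F (· + ·) (· ≤ ·)]

theorem IsLUB.inf_eq_zero {S : Set F} {p y : F} (hp : IsLUB S p) (hp0 : 0 ≤ p) (hy0 : 0 ≤ y)
    (hy : ∀ s ∈ S, y ⊓ s = 0) : y ⊓ p = 0 := by
  refine le_antisymm ?_ (le_inf hy0 hp0)
  have key : p ≤ p - y ⊓ p := hp.2 fun s hs => by
    have hinf : (y ⊓ p) ⊓ s ≤ 0 := (inf_le_inf_right s inf_le_left).trans (hy s hs).le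
    have hsup : (y ⊓ p) ⊔ s ≤ p := sup_le inf_le_right (hp.1 hs)
    rw [le_sub_iff_add_le, add_comm, ← inf_add_sup (y ⊓ p) s]
    simpa using add_le_add hinf hsup
  simpa using key

theorem inf_nsmul_eq_zero {y u : F} (hu : 0 ≤ u) (hy : y ⊓ u = 0) (n : ℕ) :
    y ⊓ n • u = 0 := by
  have hy0 : 0 ≤ y := hy.ge.trans inf_le_left
  induction n with
  | zero => simpa using hy0
  | succ n ih =>
    refine le_antisymm ?_ (le_inf hy0 (nsmul_nonneg hu _))
    refine (le_inf inf_le_left ?_).trans ih.le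
    rw [← sub_nonpos, ← hy]
    refine le_inf ?_ ?_
    · exact (sub_le_self _ (nsmul_nonneg hu n)).trans inf_le_left
    · rw [sub_le_iff_le_add', ← succ_nsmul]
      exact inf_le_right

theorem bandProj_eq_posBandProj_sub (u x : F) :
    bandProj u x = posBandProj u (x ⊔ 0) - posBandProj u (-x ⊔ 0) := rfl

theorem bandProj_of_nonneg (u : F) {x : F} (hx : 0 ≤ x) : bandProj u x = posBandProj u x := by
  rw [bandProj_eq_posBandProj_sub, sup_eq_left.2 hx, sup_eq_right.2 (neg_nonpos.2 hx),
    posBandProj_eq_self (abs_nonneg u), sub_zero]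

theorem bandProj_self (u : F) : bandProj u u = u := by
  rw [bandProj_eq_posBandProj_sub,
    posBandProj_eq_self (sup_le (le_abs_self u) (abs_nonneg u)),
    posBandProj_eq_self (sup_le (neg_le_abs u) (abs_nonneg u))]
  exact posPart_sub_negPart u

theorem inf_posBandProj_eq_zero {u x y : F} (hx : 0 ≤ x) (hy : y ⊓ |u| = 0) :
    y ⊓ posBandProj u x = 0 := by
  refine (isLUB_posBandProj u x).inf_eq_zero (posBandProj_nonneg u hx)
    (hy.ge.trans inf_le_left) ?_
  rintro _ ⟨n, rfl⟩
  have hn := nsmul_nonneg (abs_nonneg u) n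
  exact inf_eq_zero_of_le_right (inf_nsmul_eq_zero (abs_nonneg u) hy n) (le_inf hx hn)
    inf_le_right

theorem sub_posBandProj_inf_eq_zero (u x : F) : (x - posBandProj u x) ⊓ |u| = 0 := by
  set p := posBandProj u x with hp
  refine le_antisymm ?_ (le_inf (sub_nonneg.2 (posBandProj_le u x)) (abs_nonneg u))
  have key : p ≤ p - (x - p) ⊓ |u| := (isLUB_posBandProj u x).2 (by
    rintro _ ⟨n, rfl⟩
    rw [le_sub_iff_add_le]
    refine le_trans (le_inf ?_ ?_) ((isLUB_posBandProj u x).1 ⟨n + 1, rfl⟩)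
    · simpa [← hp] using add_le_add ((isLUB_posBandProj u x).1 ⟨n, rfl⟩)
        (inf_le_left : (x - p) ⊓ |u| ≤ x - p)
    · rw [succ_nsmul]
      exact add_le_add inf_le_right inf_le_right)
  simpa using key

theorem posBandProj_le_posBandProj {u v x : F} (huv : ∀ y : F, y ⊓ |v| = 0 → y ⊓ |u| = 0)
    (hx : 0 ≤ x) : posBandProj u x ≤ posBandProj v x := by
  rw [← sub_nonpos, ← inf_posBandProj_eq_zero hx (huv _ (sub_posBandProj_inf_eq_zero v x))]
  exact le_inf (sub_le_sub_right (posBandProj_le u x) _)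
    (sub_le_self _ (posBandProj_nonneg v hx))

/-- The band projection onto the band generated by `|u|` depends only on the disjoint complement
of `u`. -/
theorem bandProj_congr {u v : F} (huv : ∀ y : F, y ⊓ |u| = 0 ↔ y ⊓ |v| = 0) (x : F) :
    bandProj u x = bandProj v x := by
  have key : ∀ z : F, 0 ≤ z → posBandProj u z = posBandProj v z := fun z hz =>
    le_antisymm (posBandProj_le_posBandProj (fun y => (huv y).2) hz)
      (posBandProj_le_posBandProj (fun y => (huv y).1) hz)
  rw [bandProj_eq_posBandProj_sub, bandProj_eq_posBandProj_sub, key _ le_sup_right,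
    key _ le_sup_right]

theorem inf_abs_bandProj_eq_zero {u x y : F} (hy : y ⊓ |u| = 0) : y ⊓ |bandProj u x| = 0 := by
  rw [bandProj_eq_posBandProj_sub]
  set a := posBandProj u (x ⊔ 0)
  set b := posBandProj u (-x ⊔ 0)
  have ha : 0 ≤ a := posBandProj_nonneg u le_sup_right
  have hb : 0 ≤ b := posBandProj_nonneg u le_sup_right
  have hab : y ⊓ (a ⊔ b) = 0 := by
    refine IsLUB.inf_eq_zero (S := {a, b}) isLUB_pair (ha.trans le_sup_left)
      (hy.ge.trans inf_le_left) ?_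
    rintro s (rfl | rfl) <;> exact inf_posBandProj_eq_zero le_sup_right hy
  refine inf_eq_zero_of_le_right hab (abs_nonneg _) (abs_le'.2 ⟨?_, ?_⟩)
  · exact (sub_le_self a hb).trans le_sup_left
  · rw [neg_sub]
    exact (sub_le_self b ha).trans le_sup_right

end RieszSpace

section FAlgebra

variable {F : Type*} [CommRing F] [ConditionallyCompleteLattice F]
  [CovariantClass F F (· + ·) (· ≤ ·)] [Module ℝ F] [PosSMulMono ℝ F]

theorem UCFAlgebra.mul_le_abs_mul_abs (hF : UCFAlgebra F) (g h : F) : g * h ≤ |g| * |h| := by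
  have h₁ := hF.mul_nonneg _ _ (posPart_nonneg g) (negPart_nonneg h)
  have h₂ := hF.mul_nonneg _ _ (negPart_nonneg g) (posPart_nonneg h)
  have h₃ := add_nonneg h₁ h₂
  rw [← sub_nonneg]
  convert add_nonneg h₃ h₃ using 1
  rw [← posPart_add_negPart g, ← posPart_add_negPart h]
  nth_rewrite 3 [← posPart_sub_negPart g]
  nth_rewrite 3 [← posPart_sub_negPart h]
  ring

theorem UCFAlgebra.inf_abs_eq_zero_of_inf_posBandProj_one (hF : UCFAlgebra F) {g y : F}
    (hy : y ⊓ posBandProj g 1 = 0) : y ⊓ |g| = 0 := by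
  have hz : 0 ≤ y ⊓ |g| := le_inf (hy.ge.trans inf_le_left) (abs_nonneg g)
  refine hF.one_weak _ hz (le_antisymm ?_ (le_inf hz hF.one_pos.le))
  rw [← hy]
  refine le_inf (inf_le_left.trans inf_le_left) ?_
  rw [← sub_nonpos, ← sub_posBandProj_inf_eq_zero g 1]
  exact le_inf (sub_le_sub_right inf_le_right _)
    ((sub_le_self _ (posBandProj_nonneg g hF.one_pos.le)).trans (inf_le_left.trans inf_le_right))

/-- A canonical partial inverse has the same disjoint complement as the original element. -/
theorem IsCanonicalPartialInverse.inf_abs_eq_zero_iff (hF : UCFAlgebra F) {g h : F}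
    (hgh : IsCanonicalPartialInverse g h) (y : F) : y ⊓ |g| = 0 ↔ y ⊓ |h| = 0 := by
  obtain ⟨⟨hmul, -⟩, hband⟩ := hgh
  constructor
  · intro hy
    rw [sub_eq_zero.1 hband]
    exact inf_abs_bandProj_eq_zero hy
  · intro hy
    rw [bandProj_of_nonneg g hF.one_pos.le] at hmul
    refine hF.inf_abs_eq_zero_of_inf_posBandProj_one ?_
    have hprod : y ⊓ (|g| * |h|) = 0 := by
      rw [inf_comm, mul_comm]
      exact hF.falg _ _ _ (by rwa [inf_comm]) (abs_nonneg g)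
    exact inf_eq_zero_of_le_right hprod (posBandProj_nonneg g hF.one_pos.le)
      (hmul ▸ hF.mul_le_abs_mul_abs g h)

end FAlgebra

/-- If `h ∈ F` is the canonical partial inverse of `g ∈ F`, then `g` is
the canonical partial inverse of `h`; in particular the bands generated by `|g|` and
`|h|` coincide and `gh = hg = P_{|h|} e`. -/
theorem pi_symm {F : Type*} [CommRing F] [ConditionallyCompleteLattice F]
    [CovariantClass F F (· + ·) (· ≤ ·)] [Module ℝ F] [PosSMulMono ℝ F]
    (hF : UCFAlgebra F) (g h : F) (hgh : IsCanonicalPartialInverse g h) :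
    IsCanonicalPartialInverse h g ∧
    (∀ x : F, bandProj g x = bandProj h x) ∧
    g * h = bandProj h 1 ∧ h * g = bandProj h 1 := by
  have hP : ∀ x : F, bandProj g x = bandProj h x :=
    bandProj_congr (hgh.inf_abs_eq_zero_iff hF)
  obtain ⟨⟨h₁, h₂⟩, -⟩ := hgh
  rw [hP] at h₁ h₂
  exact ⟨⟨⟨h₂, h₁⟩, by rw [← hP, bandProj_self, sub_self]⟩, hP, h₁, h₂⟩
end

section
/- If g ∈ F⁺, then the canonical partial inverse of g is also in F⁺. -/
section

variable {F : Type*} [CommRing F] [ConditionallyCompleteLattice F]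
  [CovariantClass F F (· + ·) (· ≤ ·)]

theorem bandProj_nonneg {u x : F} (hx : ∀ n : ℕ, ((-x) ⊔ 0) ⊓ n • |u| = 0) :
    0 ≤ bandProj u x := by
  unfold bandProj
  simp only [hx, Set.range_const, csSup_singleton, sub_zero]
  refine le_csSup ⟨x ⊔ 0, ?_⟩ ⟨0, ?_⟩
  · rintro _ ⟨n, rfl⟩
    exact inf_le_left
  · simp

theorem nonpos_of_forall_nsmul_le {w b : F} (h : ∀ n : ℕ, n • w ≤ b) : w ≤ 0 := by
  have hb : BddAbove (Set.range fun n : ℕ => n • w) :=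
    ⟨b, by rintro _ ⟨n, rfl⟩; exact h n⟩
  have hs : sSup (Set.range fun n : ℕ => n • w) ≤
      sSup (Set.range fun n : ℕ => n • w) - w := by
    refine csSup_le (Set.range_nonempty _) ?_
    rintro _ ⟨n, rfl⟩
    rw [le_sub_iff_add_le, ← succ_nsmul]
    exact le_csSup hb ⟨n + 1, rfl⟩
  simpa using hs

theorem posPart_inf_negPart_eq_zero_of_sup (x : F) : (x ⊔ 0) ⊓ ((-x) ⊔ 0) = 0 :=
  posPart_inf_negPart_eq_zero x

theorem posPart_sub_negPart_of_sup (x : F) : (x ⊔ 0) - ((-x) ⊔ 0) = x :=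
  posPart_sub_negPart x

namespace UCFAlgebra

variable [Module ℝ F] [PosSMulMono ℝ F]

theorem mul_eq_zero_of_inf_eq_zero (hF : UCFAlgebra F) {x y : F} (h : x ⊓ y = 0) :
    x * y = 0 := by
  have hx : 0 ≤ x := h ▸ inf_le_left
  have hy : 0 ≤ y := h ▸ inf_le_right
  have h1 : y ⊓ (x * y) = 0 := by rw [inf_comm]; exact hF.falg x y y h hy
  simpa [mul_comm y x] using hF.falg y (x * y) x h1 hx

theorem mul_self_nonneg (hF : UCFAlgebra F) (x : F) : 0 ≤ x * x := by
  have h0 := hF.mul_eq_zero_of_inf_eq_zero (posPart_inf_negPart_eq_zero_of_sup x)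
  have hx : x * x = (x ⊔ 0) * (x ⊔ 0) + ((-x) ⊔ 0) * ((-x) ⊔ 0) := by
    conv_lhs => rw [← posPart_sub_negPart_of_sup x]
    linear_combination (-2) * h0
  rw [hx]
  exact add_nonneg (hF.mul_nonneg _ _ le_sup_right le_sup_right)
    (hF.mul_nonneg _ _ le_sup_right le_sup_right)

theorem nonpos_of_mul_self_eq_zero (hF : UCFAlgebra F) {w : F} (hw₀ : 0 ≤ w)
    (h : w * w = 0) : w ≤ 0 := by
  have hw : w + w ≤ 0 := by
    refine nonpos_of_forall_nsmul_le (b := 1) fun n => ?_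
    have hn := hF.mul_self_nonneg (1 - n * w)
    have he : (1 - n * w) * (1 - n * w) = 1 - n • (w + w) := by
      rw [nsmul_eq_mul]
      linear_combination (n : F) ^ 2 * h
    rwa [he, sub_nonneg] at hn
  exact (le_add_of_nonneg_left hw₀).trans hw

theorem inf_eq_zero_of_mul_eq_zero (hF : UCFAlgebra F) {x y : F} (hx : 0 ≤ x) (hy : 0 ≤ y)
    (h : x * y = 0) : x ⊓ y = 0 := by
  have hw : 0 ≤ x ⊓ y := le_inf hx hy
  refine le_antisymm
    (hF.nonpos_of_mul_self_eq_zero hw (le_antisymm ?_ (hF.mul_self_nonneg _))) hw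
  have h1 := hF.mul_nonneg _ _ hw (sub_nonneg.2 (inf_le_right : x ⊓ y ≤ y))
  have h2 := hF.mul_nonneg _ _ (sub_nonneg.2 (inf_le_left : x ⊓ y ≤ x)) hy
  have h3 := add_nonneg h1 h2
  have he : (x ⊓ y) * (y - x ⊓ y) + (x - x ⊓ y) * y = - ((x ⊓ y) * (x ⊓ y)) := by
    linear_combination h
  rwa [he, neg_nonneg] at h3

theorem natCast_nonneg (hF : UCFAlgebra F) (n : ℕ) : (0 : F) ≤ n := by
  rw [← nsmul_one]
  exact nsmul_nonneg hF.one_pos.le n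

theorem inf_nsmul_eq_zero (hF : UCFAlgebra F) {x y : F} (h : x ⊓ y = 0) (n : ℕ) :
    y ⊓ n • x = 0 := by
  rw [inf_comm, nsmul_eq_mul, mul_comm]
  exact hF.falg x y n h (hF.natCast_nonneg n)

theorem bandProj_one_nonneg (hF : UCFAlgebra F) (g : F) : 0 ≤ bandProj g 1 := by
  refine bandProj_nonneg fun n => ?_
  rw [sup_eq_right.2 (neg_nonpos.2 hF.one_pos.le)]
  exact inf_eq_left.2 (nsmul_nonneg (abs_nonneg g) n)

/-- If `g` and `g * h` are positive, then `g` annihilates the negative part of `h`. -/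
theorem mul_negPart_eq_zero (hF : UCFAlgebra F) {g h : F} (hg : 0 ≤ g) (hgh : 0 ≤ g * h) :
    g * ((-h) ⊔ 0) = 0 := by
  have h1 := hF.falg _ _ g (posPart_inf_negPart_eq_zero_of_sup h) hg
  rw [inf_comm] at h1
  have h2 := hF.falg _ _ g h1 hg
  have hle : ((-h) ⊔ 0) * g ≤ (h ⊔ 0) * g := by
    rw [← sub_nonneg, ← sub_mul, posPart_sub_negPart_of_sup, mul_comm]
    exact hgh
  rw [inf_eq_left.2 hle] at h2
  rw [mul_comm, h2]

end UCFAlgebra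

end

/-- If `g ∈ F⁺`, then the canonical partial inverse of `g` is also in
`F⁺`. -/
theorem pi_pos {F : Type*} [CommRing F] [ConditionallyCompleteLattice F]
    [CovariantClass F F (· + ·) (· ≤ ·)] [Module ℝ F] [PosSMulMono ℝ F]
    (hF : UCFAlgebra F) (g h : F) (hg : 0 ≤ g)
    (hgh : IsCanonicalPartialInverse g h) :
    0 ≤ h := by
  obtain ⟨⟨hmul, -⟩, hband⟩ := hgh
  have hzero := hF.mul_negPart_eq_zero hg (hmul ▸ hF.bandProj_one_nonneg g)
  have hdisj := hF.inf_eq_zero_of_mul_eq_zero hg le_sup_right hzero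
  rw [sub_eq_zero.1 hband]
  refine bandProj_nonneg fun n => ?_
  rw [abs_of_nonneg hg]
  exact hF.inf_nsmul_eq_zero hdisj n
end
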